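/- Let f : ℕ → ℕ satisfy the controlled growth requirement and f(n) = o(n^{3/2}). Then there exists a non-empty activator sequence V on G(f) such that δ(G(f),V) = 1, i.e., |B_n|/|V(G_n)| → 1 as n → ∞. -/

import Mathlib

open Filter Asymptotics

/-- Membership in the grid `[-f n, f n]^2 ⊆ ℤ × ℤ`. -/
def inGrid (f : ℕ → ℕ) (n : ℕ) (p : ℤ × ℤ) : Prop :=
  |p.1| ≤ (f n : ℤ) ∧ |p.2| ≤ (f n : ℤ)

instance (f : ℕ → ℕ) (n : ℕ) : DecidablePred (inGrid f n) := fun _ => by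
  unfold inGrid; infer_instance

/-- The four lattice neighbours (at `L¹`-distance one) of a point. -/
def nbrs (p : ℤ × ℤ) : Finset (ℤ × ℤ) :=
  {(p.1 + 1, p.2), (p.1 - 1, p.2), (p.1, p.2 + 1), (p.1, p.2 - 1)}

/-- An activator sequence: whenever `V n ≠ ∅` (for `n ≥ 1`), the activated vertex
lies in the grid at time `n`. -/
def IsActivator (f : ℕ → ℕ) (V : ℕ → Option (ℤ × ℤ)) : Prop :=
  ∀ n, 1 ≤ n → ∀ p, V n = some p → inGrid f n p

/-- The burning process: `B 0 = ∅`, and `B n` is obtained from `B (n-1)` by adding all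
vertices of the grid at time `n` adjacent to a vertex of `B (n-1)`, and then adding
the activator `V n` if it is not `∅`. -/
def burnSet (f : ℕ → ℕ) (V : ℕ → Option (ℤ × ℤ)) : ℕ → Finset (ℤ × ℤ)
  | 0 => ∅
  | n + 1 =>
    let B := burnSet f V n
    let spread := B ∪ (B.biUnion nbrs).filter (inGrid f (n + 1))
    match V (n + 1) with
    | none => spread
    | some v => insert v spread

/-- The proportion `|B n| / |V(G n)|` of burning vertices at time `n`. -/
noncomputable def densitySeq (f : ℕ → ℕ) (V : ℕ → Option (ℤ × ℤ)) (n : ℕ) : ℝ :=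
  ((burnSet f V n).card : ℝ) / (2 * (f n : ℝ) + 1) ^ 2

/-- The lower burning density `δ̲(G(f), V)`. -/
noncomputable def lowerDensity (f : ℕ → ℕ) (V : ℕ → Option (ℤ × ℤ)) : ℝ :=
  liminf (densitySeq f V) atTop

/-- The upper burning density `δ̄(G(f), V)`. -/
noncomputable def upperDensity (f : ℕ → ℕ) (V : ℕ → Option (ℤ × ℤ)) : ℝ :=
  limsup (densitySeq f V) atTop

/-- The burning density of `V` in `G(f)` exists and equals `ρ`. -/
def HasBurningDensity (f : ℕ → ℕ) (V : ℕ → Option (ℤ × ℤ)) (ρ : ℝ) : Prop :=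
  Tendsto (densitySeq f V) atTop (nhds ρ)

/-- `P(G(f))`: the set of `ρ ∈ [0,1]` achievable as the burning density of some
non-empty activator sequence. -/
def densSet (f : ℕ → ℕ) : Set ℝ :=
  {ρ | ρ ∈ Set.Icc (0 : ℝ) 1 ∧
    ∃ V : ℕ → Option (ℤ × ℤ), IsActivator f V ∧ (∃ t, 1 ≤ t ∧ V t ≠ none) ∧
      HasBurningDensity f V ρ}

/-- The controlled growth requirement. -/
def ControlledGrowth (f : ℕ → ℕ) : Prop :=
  (∀ᶠ n in atTop, f n < f (n + 1)) ∧
  (∀ ε : ℕ → ℕ, (fun n => (ε n : ℝ)) =o[atTop] (fun n => (n : ℝ)) →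
    Tendsto (fun n => (f (n + ε n) : ℝ) / (f n : ℝ)) atTop (nhds 1)) ∧
  (∀ c : ℝ, 0 < c → ∃ d : ℝ, 0 < d ∧
    ∀ᶠ n in atTop, (1 + d) * (f n : ℝ) ≤ (f (n + ⌈c * n⌉₊) : ℝ))

/-- The least `q` with `2 * F < q ^ 3`. -/
def coverSize (F : ℕ) : ℕ :=
  Nat.find (p := fun q => 2 * F < q ^ 3)
    ⟨2 * F + 1, lt_of_lt_of_le (Nat.lt_succ_self _) (Nat.le_self_pow (by norm_num) _)⟩

lemma lt_coverSize_pow (F : ℕ) : 2 * F < coverSize F ^ 3 :=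
  Nat.find_spec (p := fun q => 2 * F < q ^ 3) _

lemma coverSize_pos (F : ℕ) : 0 < coverSize F := by
  rcases Nat.eq_zero_or_pos (coverSize F) with h | h
  · have := lt_coverSize_pow F
    simp [h] at this
  · exact h

lemma coverSize_mono {F F' : ℕ} (h : F ≤ F') : coverSize F ≤ coverSize F' :=
  Nat.find_min' _ (lt_of_le_of_lt (by omega) (lt_coverSize_pow F'))

lemma coverSize_pow_le {F : ℕ} (hF : 1 ≤ F) : coverSize F ^ 3 ≤ 16 * F := by
  have h2 : 2 ≤ coverSize F := by
    by_contra! h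
    have h1 : coverSize F = 1 := by have := coverSize_pos F; omega
    have := lt_coverSize_pow F
    rw [h1] at this
    omega
  have hpred : (coverSize F - 1) ^ 3 ≤ 2 * F :=
    not_lt.mp (Nat.find_min (p := fun q => 2 * F < q ^ 3) _
      (show coverSize F - 1 < coverSize F by omega))
  calc coverSize F ^ 3 ≤ (2 * (coverSize F - 1)) ^ 3 := Nat.pow_le_pow_left (by omega) 3
    _ = 8 * (coverSize F - 1) ^ 3 := by ring
    _ ≤ 16 * F := by omega

/-- The length of a block of activations started at time `n`. -/
def blockLen (f : ℕ → ℕ) (n : ℕ) : ℕ := 2 * coverSize (f n) ^ 2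

lemma blockLen_pos (f : ℕ → ℕ) (n : ℕ) : 0 < blockLen f n := by
  have := coverSize_pos (f n)
  unfold blockLen
  positivity

lemma blockLen_mono {f : ℕ → ℕ} {m n : ℕ} (h : f m ≤ f n) : blockLen f m ≤ blockLen f n :=
  Nat.mul_le_mul_left 2 (Nat.pow_le_pow_left (coverSize_mono h) 2)

lemma blockLen_isLittleO {f : ℕ → ℕ} (hf : ∀ᶠ n in atTop, 1 ≤ f n)
    (hlittleo : (fun n => (f n : ℝ)) =o[atTop] fun n => (n : ℝ) ^ ((3 : ℝ) / 2)) :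
    (fun n => (blockLen f n : ℝ)) =o[atTop] fun n => (n : ℝ) := by
  rw [isLittleO_iff]
  intro c hc
  have hd : (0 : ℝ) < Real.sqrt (c ^ 3 / 2048) := by positivity
  filter_upwards [hf, (isLittleO_iff.mp hlittleo) hd] with n h1 h2
  have hn : (0 : ℝ) ≤ n := n.cast_nonneg
  rw [Real.norm_of_nonneg (Nat.cast_nonneg _), Real.norm_of_nonneg (by positivity)] at h2 ⊢
  have hsq : (f n : ℝ) ^ 2 ≤ c ^ 3 / 2048 * (n : ℝ) ^ 3 := by
    calc (f n : ℝ) ^ 2 ≤ (Real.sqrt (c ^ 3 / 2048) * (n : ℝ) ^ ((3 : ℝ) / 2)) ^ 2 := by gcongr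
      _ = c ^ 3 / 2048 * (n : ℝ) ^ 3 := by
        rw [mul_pow, Real.sq_sqrt (by positivity), ← Real.rpow_mul_natCast hn]
        norm_num
  have hq : (coverSize (f n) : ℝ) ^ 3 ≤ 16 * f n := by exact_mod_cast coverSize_pow_le h1
  have hcube : (blockLen f n : ℝ) ^ 3 ≤ (c * n) ^ 3 := by
    calc (blockLen f n : ℝ) ^ 3 = 8 * ((coverSize (f n) : ℝ) ^ 3) ^ 2 := by
          simp only [blockLen, Nat.cast_mul, Nat.cast_pow, Nat.cast_ofNat]; ring
      _ ≤ 8 * (16 * (f n : ℝ)) ^ 2 := by gcongr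
      _ = 2048 * (f n : ℝ) ^ 2 := by ring
      _ ≤ 2048 * (c ^ 3 / 2048 * (n : ℝ) ^ 3) := by gcongr
      _ = (c * n) ^ 3 := by ring
  exact le_of_pow_le_pow_left₀ (by norm_num) (by positivity) hcube

/-- The start of the block containing time `t`, for consecutive blocks of which the first
starts at `N` and the one starting at `m` has length `ℓ m`. -/
def blockStart (ℓ : ℕ → ℕ) (N : ℕ) : ℕ → ℕ
  | 0 => N
  | t + 1 =>
    if blockStart ℓ N t + ℓ (blockStart ℓ N t) ≤ t + 1 then t + 1 else blockStart ℓ N t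

section BlockStart

variable {ℓ : ℕ → ℕ} {N : ℕ}

lemma lt_blockStart_add (hℓ : ∀ n, 0 < ℓ n) (t : ℕ) :
    t < blockStart ℓ N t + ℓ (blockStart ℓ N t) := by
  induction t with
  | zero => exact Nat.add_pos_right _ (hℓ _)
  | succ t ih =>
    rw [blockStart]
    have := hℓ (t + 1)
    split_ifs <;> omega

lemma blockStart_of_le {t : ℕ} (hℓ : ∀ n, 0 < ℓ n) (ht : t ≤ N) : blockStart ℓ N t = N := by
  induction t with
  | zero => rfl
  | succ t ih =>
    have := hℓ N
    rw [blockStart, ih (by omega), if_neg (by omega)]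

lemma blockStart_spec {t : ℕ} (hℓ : ∀ n, 0 < ℓ n) (ht : N ≤ t) :
    N ≤ blockStart ℓ N t ∧ blockStart ℓ N t ≤ t ∧
      blockStart ℓ N (blockStart ℓ N t) = blockStart ℓ N t := by
  induction t, ht using Nat.le_induction with
  | base => simp [blockStart_of_le hℓ le_rfl]
  | succ t ht ih =>
    by_cases h : blockStart ℓ N t + ℓ (blockStart ℓ N t) ≤ t + 1
    · have e : blockStart ℓ N (t + 1) = t + 1 := by rw [blockStart, if_pos h]
      rw [e]
      exact ⟨by omega, le_rfl, e⟩
    · have e : blockStart ℓ N (t + 1) = blockStart ℓ N t := by rw [blockStart, if_neg h]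
      rw [e]
      exact ⟨ih.1, by omega, ih.2.2⟩

lemma blockStart_add {m i : ℕ} (hm : blockStart ℓ N m = m) (hi : i < ℓ m) :
    blockStart ℓ N (m + i) = m := by
  induction i with
  | zero => exact hm
  | succ i ih =>
    rw [← add_assoc, blockStart, ih (by omega), if_neg (by omega)]

lemma exists_previous_block {b : ℕ} (hℓ : ∀ n, 0 < ℓ n) (hb : blockStart ℓ N b = b)
    (hN : N < b) : ∃ m, N ≤ m ∧ blockStart ℓ N m = m ∧ m + ℓ m = b := by
  obtain ⟨u, rfl⟩ : ∃ u, b = u + 1 := ⟨b - 1, by omega⟩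
  have hu := blockStart_spec hℓ (show N ≤ u by omega)
  have hlt := lt_blockStart_add (N := N) hℓ u
  refine ⟨blockStart ℓ N u, hu.1, hu.2.2, ?_⟩
  rw [blockStart] at hb
  split_ifs at hb <;> omega

lemma exists_completed_block (hℓ : ∀ n, 0 < ℓ n)
    (hmono : ∀ m n, N ≤ m → m ≤ n → ℓ m ≤ ℓ n) :
    ∀ᶠ n in atTop, ∃ m, N ≤ m ∧ blockStart ℓ N m = m ∧ m + 2 * ℓ m ≤ n ∧
      n ≤ m + 3 * ℓ n := by
  filter_upwards [eventually_ge_atTop (N + ℓ N + ℓ (N + ℓ N))] with n hn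
  obtain ⟨h1, h2, h3⟩ := blockStart_spec hℓ (show N ≤ n by omega)
  have hlt := lt_blockStart_add (N := N) hℓ n
  generalize blockStart ℓ N n = b at *
  have hb : N < b := by
    refine lt_of_le_of_ne h1 ?_
    rintro rfl
    omega
  obtain ⟨m₁, hm₁, hs₁, rfl⟩ := exists_previous_block hℓ h3 hb
  have hb₁ : N < m₁ := by
    refine lt_of_le_of_ne hm₁ ?_
    rintro rfl
    omega
  obtain ⟨m, hm, hs, rfl⟩ := exists_previous_block hℓ hs₁ hb₁
  have := hmono m (m + ℓ m) hm (by omega)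
  have := hmono m n hm (by omega)
  have := hmono (m + ℓ m) n (by omega) (by omega)
  have := hmono (m + ℓ m + ℓ (m + ℓ m)) n (by omega) h2
  exact ⟨m, hm, hs, by omega, by omega⟩

end BlockStart

section Burning

variable {f : ℕ → ℕ} {V : ℕ → Option (ℤ × ℤ)}

lemma mem_burnSet_succ {n : ℕ} {p : ℤ × ℤ} :
    p ∈ burnSet f V (n + 1) ↔ V (n + 1) = some p ∨ p ∈ burnSet f V n ∨
      ((∃ v ∈ burnSet f V n, p ∈ nbrs v) ∧ inGrid f (n + 1) p) := by
  rw [burnSet]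
  cases h : V (n + 1) with
  | none => simp
  | some v => simp [eq_comm]

lemma burnSet_mono : Monotone (burnSet f V) :=
  monotone_nat_of_le_succ fun _ _ hp => mem_burnSet_succ.mpr (Or.inr (Or.inl hp))

lemma mem_burnSet_of_activated {n : ℕ} {p : ℤ × ℤ} (hn : 1 ≤ n) (h : V n = some p) :
    p ∈ burnSet f V n := by
  obtain ⟨n, rfl⟩ : ∃ k, n = k + 1 := ⟨n - 1, by omega⟩
  exact mem_burnSet_succ.mpr (Or.inl h)

lemma burnSet_spread {m t k : ℕ} {v p : ℤ × ℤ} (hf : ∀ n, m ≤ n → f m ≤ f n) (hmt : m ≤ t)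
    (hv : v ∈ burnSet f V t) (hvm : inGrid f m v) (hpm : inGrid f m p)
    (hd : |p.1 - v.1| + |p.2 - v.2| ≤ k) : p ∈ burnSet f V (t + k) := by
  induction k generalizing p with
  | zero =>
    have : p = v := by
      ext <;> grind
    exact this ▸ hv
  | succ k ih =>
    have hft := hf (t + k + 1) (by omega)
    have hgrid : inGrid f (t + k + 1) p := by
      unfold inGrid at *
      omega
    have step : ∀ p' : ℤ × ℤ, p ∈ nbrs p' → inGrid f m p' →
        |p'.1 - v.1| + |p'.2 - v.2| ≤ k → p ∈ burnSet f V (t + (k + 1)) := fun p' h1 h2 h3 =>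
      mem_burnSet_succ.mpr (Or.inr (Or.inr ⟨⟨p', ih h2 h3, h1⟩, hgrid⟩))
    obtain ⟨x, y⟩ := p
    obtain ⟨a, b⟩ := v
    simp only [inGrid, abs_le] at *
    rcases lt_trichotomy x a with h | h | h
    · exact step (x + 1, y) (by simp [nbrs]) (by grind) (by grind)
    · rcases lt_trichotomy y b with h' | h' | h'
      · exact step (x, y + 1) (by simp [nbrs]) (by grind) (by grind)
      · subst h h'
        exact burnSet_mono (Nat.le_add_right t (k + 1)) hv
      · exact step (x, y - 1) (by simp [nbrs]) (by grind) (by grind)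
    · exact step (x - 1, y) (by simp [nbrs]) (by grind) (by grind)

lemma inGrid_of_mem_burnSet {N n : ℕ} {p : ℤ × ℤ} (hV : IsActivator f V)
    (hN : ∀ t, t < N → V t = none) (hf : ∀ m n, N ≤ m → m ≤ n → f m ≤ f n)
    (hp : p ∈ burnSet f V n) : N ≤ n ∧ inGrid f n p := by
  induction n generalizing p with
  | zero => simp [burnSet] at hp
  | succ n ih =>
    rcases mem_burnSet_succ.mp hp with h | h | ⟨⟨v, hv, -⟩, h⟩
    · refine ⟨?_, hV _ (by omega) p h⟩
      by_contra! hlt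
      simp [hN _ hlt] at h
    · obtain ⟨h1, h2⟩ := ih h
      have := hf n (n + 1) h1 (by omega)
      unfold inGrid at *
      omega
    · have := (ih hv).1
      exact ⟨by omega, h⟩

end Burning

/-- The vertices of the grid at time `n`. -/
noncomputable def gridFinset (f : ℕ → ℕ) (n : ℕ) : Finset (ℤ × ℤ) :=
  Finset.Icc (-(f n : ℤ)) (f n) ×ˢ Finset.Icc (-(f n : ℤ)) (f n)

lemma mem_gridFinset {f : ℕ → ℕ} {n : ℕ} {p : ℤ × ℤ} :
    p ∈ gridFinset f n ↔ inGrid f n p := by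
  simp [gridFinset, inGrid, abs_le]

lemma card_gridFinset (f : ℕ → ℕ) (n : ℕ) : (gridFinset f n).card = (2 * f n + 1) ^ 2 := by
  rw [gridFinset, Finset.card_product, Int.card_Icc, sq]
  congr 1 <;> omega

/-- The `i`-th point of a `q × q` array of step `q ^ 2` with corner `(-F, -F)`. -/
def arrayPoint (F q i : ℕ) : ℤ × ℤ :=
  (-F + (i / q : ℕ) * (q : ℤ) ^ 2, -F + (i % q : ℕ) * (q : ℤ) ^ 2)

lemma exists_near_multiple {F q : ℕ} (hq : 2 * F < q ^ 3) {x : ℤ} (hx : |x| ≤ F) :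
    ∃ a < q, -(F : ℤ) + a * (q : ℤ) ^ 2 ≤ x ∧ x ≤ -(F : ℤ) + a * (q : ℤ) ^ 2 + (q : ℤ) ^ 2 := by
  rw [abs_le] at hx
  have hq0 : 0 < q := Nat.pos_of_ne_zero fun h => by simp [h] at hq
  obtain ⟨y, hy⟩ : ∃ y : ℕ, x + F = y := ⟨(x + F).toNat, by omega⟩
  have hy2 : y < q ^ 3 := by omega
  refine ⟨y / q ^ 2, Nat.div_lt_of_lt_mul (by rwa [← pow_succ]), ?_⟩
  have h1 : q ^ 2 * (y / q ^ 2) + y % q ^ 2 = y := Nat.div_add_mod y (q ^ 2)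
  have h2 : y % q ^ 2 < q ^ 2 := Nat.mod_lt _ (by positivity)
  generalize y / q ^ 2 = a at *
  generalize y % q ^ 2 = b at *
  zify at h1 h2
  rw [mul_comm] at h1
  constructor <;> linarith

lemma exists_near_arrayPoint {f : ℕ → ℕ} {n q : ℕ} (hq : 2 * f n < q ^ 3) {p : ℤ × ℤ}
    (hp : inGrid f n p) :
    ∃ i < q ^ 2, inGrid f n (arrayPoint (f n) q i) ∧
      |p.1 - (arrayPoint (f n) q i).1| + |p.2 - (arrayPoint (f n) q i).2| ≤ 2 * (q : ℤ) ^ 2 := by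
  obtain ⟨a, ha, ha1, ha2⟩ := exists_near_multiple hq hp.1
  obtain ⟨b, hb, hb1, hb2⟩ := exists_near_multiple hq hp.2
  have hdiv : (a * q + b) / q = a := by
    rw [mul_comm, Nat.mul_add_div (by omega), Nat.div_eq_of_lt hb, add_zero]
  have hmod : (a * q + b) % q = b := by
    rw [mul_comm, Nat.mul_add_mod, Nat.mod_eq_of_lt hb]
  have hpos : 0 ≤ (a : ℤ) * (q : ℤ) ^ 2 := by positivity
  have hpos' : 0 ≤ (b : ℤ) * (q : ℤ) ^ 2 := by positivity
  refine ⟨a * q + b, by nlinarith, ?_⟩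
  simp only [inGrid, abs_le, arrayPoint, hdiv, hmod] at hp ⊢
  refine ⟨by omega, ?_⟩
  rw [abs_of_nonneg (by omega), abs_of_nonneg (by omega)]
  omega

/-- Activate, block after block from time `N` on, an array covering the grid at the start of
the block. -/
def blockActivator (f : ℕ → ℕ) (N t : ℕ) : Option (ℤ × ℤ) :=
  let m := blockStart (blockLen f) N t
  let p := arrayPoint (f m) (coverSize (f m)) (t - m)
  if N ≤ t ∧ inGrid f t p then some p else none

lemma isActivator_blockActivator (f : ℕ → ℕ) (N : ℕ) : IsActivator f (blockActivator f N) := by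
  intro n _ p hp
  simp only [blockActivator, Option.ite_none_right_eq_some, Option.some.injEq] at hp
  exact hp.2 ▸ hp.1.2

lemma blockActivator_of_lt {f : ℕ → ℕ} {N t : ℕ} (h : t < N) : blockActivator f N t = none :=
  if_neg fun h' => absurd h'.1 (by omega)

lemma blockActivator_block {f : ℕ → ℕ} {N m i : ℕ} (hf : ∀ n, m ≤ n → f m ≤ f n) (hN : N ≤ m)
    (hm : blockStart (blockLen f) N m = m) (hi : i < blockLen f m)
    (hp : inGrid f m (arrayPoint (f m) (coverSize (f m)) i)) :
    blockActivator f N (m + i) = some (arrayPoint (f m) (coverSize (f m)) i) := by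
  have h := hf (m + i) (by omega)
  simp only [blockActivator, blockStart_add hm hi, Nat.add_sub_cancel_left]
  refine if_pos ⟨by omega, ?_⟩
  unfold inGrid at *
  omega

lemma gridFinset_subset_burnSet {f : ℕ → ℕ} {N m n : ℕ} (hN : 1 ≤ N)
    (hf : ∀ n, m ≤ n → f m ≤ f n) (hNm : N ≤ m) (hm : blockStart (blockLen f) N m = m)
    (hn : m + 2 * blockLen f m ≤ n) : gridFinset f m ⊆ burnSet f (blockActivator f N) n := by
  intro p hp
  rw [mem_gridFinset] at hp
  obtain ⟨i, hi, hgrid, hdist⟩ := exists_near_arrayPoint (lt_coverSize_pow (f m)) hp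
  have hi' : i < blockLen f m := by unfold blockLen; omega
  have hact := mem_burnSet_of_activated (f := f) (by omega)
    (blockActivator_block hf hNm hm hi' hgrid)
  refine burnSet_mono (by omega : m + i + blockLen f m ≤ n)
    (burnSet_spread hf (by omega) hact hgrid hp ?_)
  simpa [blockLen] using hdist

/-- if `f` has controlled growth and `f(n) = o(n^(3/2))`, then there is a
non-empty activator sequence with burning density `1`. -/
theorem density_one_achievable (f : ℕ → ℕ) (hcg : ControlledGrowth f)
    (hlittleo : (fun n => (f n : ℝ)) =o[atTop] fun n => (n : ℝ) ^ ((3 : ℝ) / 2)) :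
    ∃ V : ℕ → Option (ℤ × ℤ), IsActivator f V ∧ (∃ t, 1 ≤ t ∧ V t ≠ none) ∧
      HasBurningDensity f V 1 := by
  obtain ⟨N, hN, hfN, hstep⟩ : ∃ N, 1 ≤ N ∧ 1 ≤ f N ∧ ∀ n, N ≤ n → f n ≤ f (n + 1) := by
    obtain ⟨N, hN⟩ := eventually_atTop.mp hcg.1
    exact ⟨N + 1, by omega, by have := hN N le_rfl; omega, fun n hn => (hN n (by omega)).le⟩
  have hmono : ∀ m n, N ≤ m → m ≤ n → f m ≤ f n := fun m n hm hmn =>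
    Nat.le_induction le_rfl (fun k hk ih => ih.trans (hstep k (hm.trans hk))) n hmn
  have hfpos : ∀ n, N ≤ n → 1 ≤ f n := fun n hn => hfN.trans (hmono N n le_rfl hn)
  have hlen : (fun n => (blockLen f n : ℝ)) =o[atTop] fun n => (n : ℝ) :=
    blockLen_isLittleO ((eventually_ge_atTop N).mono hfpos) hlittleo
  have hpos := blockLen_pos f
  have hact := isActivator_blockActivator f N
  refine ⟨blockActivator f N, hact, ⟨N, by omega, ?_⟩, ?_⟩
  · have h := blockActivator_block (f := f) (i := 0) (fun n hn => hmono N n le_rfl hn) le_rfl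
      (blockStart_of_le hpos le_rfl) (hpos N) (by simp [arrayPoint, inGrid])
    simp only [add_zero] at h
    simp [h]
  obtain ⟨K, hK⟩ := eventually_atTop.mp (exists_completed_block (N := N) hpos
    fun m n hm hmn => blockLen_mono (hmono m n hm hmn))
  choose! a haN haS haL haU using hK
  have hhalf : ∀ᶠ n in atTop, n ≤ 2 * a n := by
    filter_upwards [isLittleO_iff.mp hlen (show (0 : ℝ) < 1 / 6 by norm_num),
      eventually_ge_atTop K] with n h1 h2
    have h3 := haU n h2
    simp only [Real.norm_natCast] at h1
    have : 6 * blockLen f n ≤ n := by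
      have : (6 : ℝ) * blockLen f n ≤ n := by linarith
      exact_mod_cast this
    omega
  have ha : Tendsto a atTop atTop := by
    refine tendsto_atTop.mpr fun b => ?_
    filter_upwards [hhalf, eventually_ge_atTop (2 * b)] with n h1 h2
    omega
  let ε : ℕ → ℕ := fun m => 3 * blockLen f (2 * m)
  have hε : (fun n => (ε n : ℝ)) =o[atTop] fun n => (n : ℝ) := by
    have h2 : Tendsto (fun m : ℕ => 2 * m) atTop atTop :=
      tendsto_atTop_mono (fun m => Nat.le_mul_of_pos_left m two_pos) tendsto_id
    have hdouble : ((fun n : ℕ => (n : ℝ)) ∘ fun m => 2 * m) =O[atTop] fun m : ℕ => (m : ℝ) :=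
      IsBigO.of_bound 2 (Eventually.of_forall fun m => by simp)
    simpa [ε, Function.comp_def] using
      ((hlen.comp_tendsto h2).trans_isBigO hdouble).const_mul_left 3
  have hratio : Tendsto (fun n => (((f (a n + ε (a n)) : ℝ) / f (a n))⁻¹) ^ 2) atTop (nhds 1) := by
    simpa using (((hcg.2.1 ε hε).comp ha).inv₀ one_ne_zero).pow 2
  refine tendsto_of_tendsto_of_tendsto_of_le_of_le' hratio tendsto_const_nhds ?_ ?_
  · filter_upwards [hhalf, eventually_ge_atTop K, eventually_ge_atTop N] with n h1 h2 h3
    have hle : a n ≤ n := by have := haL n h2; omega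
    have hn : n ≤ a n + ε (a n) := by
      have h4 := haU n h2
      have h5 := blockLen_mono (hmono n (2 * a n) h3 h1)
      simp only [ε]
      omega
    have hf₁ : (1 : ℝ) ≤ f (a n) := by exact_mod_cast hfpos _ (haN n h2)
    have hf₂ : (f (a n) : ℝ) ≤ f n := by exact_mod_cast hmono _ _ (haN n h2) hle
    have hf₃ : (f n : ℝ) ≤ f (a n + ε (a n)) := by exact_mod_cast hmono _ _ h3 hn
    have hcard : ((2 * f (a n) + 1 : ℝ)) ^ 2 ≤ (burnSet f (blockActivator f N) n).card := by
      have := Finset.card_le_card (gridFinset_subset_burnSet (by omega)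
        (fun k hk => hmono _ k (haN n h2) hk) (haN n h2) (haS n h2) (haL n h2))
      rw [card_gridFinset] at this
      exact_mod_cast this
    calc (((f (a n + ε (a n)) : ℝ) / f (a n))⁻¹) ^ 2
        = ((f (a n) : ℝ) / f (a n + ε (a n))) ^ 2 := by rw [inv_div]
      _ ≤ ((2 * f (a n) + 1 : ℝ) / (2 * f n + 1)) ^ 2 := by
        refine pow_le_pow_left₀ (by positivity) ?_ 2
        rw [div_le_div_iff₀ (by linarith) (by linarith)]
        nlinarith
      _ = (2 * f (a n) + 1 : ℝ) ^ 2 / (2 * f n + 1) ^ 2 := by rw [div_pow]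
      _ ≤ densitySeq f (blockActivator f N) n := by
        unfold densitySeq
        gcongr
  · refine Eventually.of_forall fun n => ?_
    refine div_le_one_of_le₀ ?_ (by positivity)
    have := Finset.card_le_card (fun p hp => mem_gridFinset.mpr
      (inGrid_of_mem_burnSet hact (fun _ => blockActivator_of_lt) hmono hp).2 :
        burnSet f (blockActivator f N) n ⊆ gridFinset f n)
    rw [card_gridFinset] at this
    exact_mod_cast this
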